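/- For any interaction system w on S, the identity relation on S is an isomorphism in Int between w and 𝓕(w°), where 𝓕(w°) is the interaction system on S with A'(s) = {x ⊆ S | s ∈ w°(x)}, D'(s,x) = x, and n'(s,x,s') = s'. (Together with 𝓕(F)° = F for monotone F, this shows that Int and the category PT of predicate transformers are equivalent, and that this equivalence is a retract.) -/

import Mathlib

/-- An interaction system on a set (type) of states `S`. -/
structure IS (S : Type) where
  A : S → Type
  D : (s : S) → A s → Type
  n : (s : S) → (a : A s) → D s a → S

/-- `r` is a simulation from `w1` to `w2`. -/
def Sim {S1 S2 : Type} (w1 : IS S1) (w2 : IS S2) (r : Set (S1 × S2)) : Prop :=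
  ∀ ⦃s1 : S1⦄ ⦃s2 : S2⦄, (s1, s2) ∈ r →
    ∀ a1 : w1.A s1, ∃ a2 : w2.A s2,
      ∀ d2 : w2.D s2 a2, ∃ d1 : w1.D s1 a1,
        (w1.n s1 a1 d1, w2.n s2 a2 d2) ∈ r

/-- Relational composition `r2 · r1` (first `r1`, then `r2`). -/
def relComp {S1 S2 S3 : Type} (r2 : Set (S2 × S3)) (r1 : Set (S1 × S2)) :
    Set (S1 × S3) :=
  {p | ∃ s2, (p.1, s2) ∈ r1 ∧ (s2, p.2) ∈ r2}

/-- The identity relation. -/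
def idSRel {S : Type} : Set (S × S) := {p | p.1 = p.2}

/-- The converse of a relation. -/
def relConv {S1 S2 : Type} (r : Set (S1 × S2)) : Set (S2 × S1) :=
  {p | (p.2, p.1) ∈ r}

/-- The predicate transformer `w°` associated to `w`. -/
def pt {S : Type} (w : IS S) : Set S → Set S :=
  fun x => {s | ∃ a : w.A s, ∀ d : w.D s a, w.n s a d ∈ x}

/-- The interaction system associated to a predicate transformer. -/
def FIS {S : Type} (F : Set S → Set S) : IS S where
  A s := {x : Set S // s ∈ F x}
  D _ x := ↥x.val
  n _ _ s' := s'.val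

/-- The identity relation is an isomorphism between `w` and `FIS (pt w)`. -/
theorem iso_with_FIS_pt {S : Type} (w : IS S) :
    Sim w (FIS (pt w)) (idSRel : Set (S × S)) ∧
    Sim (FIS (pt w)) w (idSRel : Set (S × S)) := by
  constructor
  · rintro s _ (rfl : s = _) a
    exact ⟨⟨Set.range (w.n s a), a, Set.mem_range_self⟩, fun ⟨_, d, hd⟩ => ⟨d, hd⟩⟩
  · rintro s _ (rfl : s = _) ⟨x, a, ha⟩
    exact ⟨a, fun d => ⟨⟨w.n s a d, ha d⟩, rfl⟩⟩
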